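/- Let k be a field of characteristic zero and let A₁ and A₂ be commutative k-algebras each admitting a nonzero locally nilpotent k-derivation (equivalently, ML(Aᵢ) ≠ Aᵢ for i = 1, 2). Then the Derksen invariant of A₁ ⊗_k A₂ equals all of A₁ ⊗_k A₂; that is, the k-subalgebra of A₁ ⊗_k A₂ generated by the union of the kernels of all nonzero locally nilpotent k-derivations of A₁ ⊗_k A₂ is the whole algebra. -/

import Mathlib

/-- A derivation `D` is locally nilpotent if for every `a` some positive iterate of `D`
kills `a`. -/
def Derivation.IsLocallyNilpotent {k A : Type*} [CommRing k] [CommRing A] [Algebra k A]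
    (D : Derivation k A A) : Prop :=
  ∀ a : A, ∃ n : ℕ, 0 < n ∧ (⇑D)^[n] a = 0

/-- The kernel of a derivation `D : A → A`, as a `k`-subalgebra of `A`. -/
def Derivation.kerSubalgebra {k A : Type*} [CommRing k] [CommRing A] [Algebra k A]
    (D : Derivation k A A) : Subalgebra k A where
  carrier := {a : A | D a = 0}
  add_mem' := by
    intro a b ha hb
    simp only [Set.mem_setOf_eq] at *
    rw [map_add, ha, hb, add_zero]
  mul_mem' := by
    intro a b ha hb
    simp only [Set.mem_setOf_eq] at *
    rw [Derivation.leibniz, ha, hb, smul_zero, smul_zero, add_zero]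
  algebraMap_mem' := fun r => by
    simp only [Set.mem_setOf_eq, Derivation.map_algebraMap]

/-- The Makar-Limanov invariant of a commutative `k`-algebra `A`: the intersection of the
kernels of all locally nilpotent `k`-derivations of `A`. -/
def MakarLimanov (k A : Type*) [CommRing k] [CommRing A] [Algebra k A] : Subalgebra k A :=
  ⨅ D : {D : Derivation k A A // D.IsLocallyNilpotent}, (D : Derivation k A A).kerSubalgebra

/-- The Derksen invariant of a commutative `k`-algebra `A`: the `k`-subalgebra generated by
the union of the kernels of all nonzero locally nilpotent `k`-derivations of `A`. -/
def Derksen (k A : Type*) [CommRing k] [CommRing A] [Algebra k A] : Subalgebra k A :=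
  Algebra.adjoin k
    (⋃ D ∈ {D : Derivation k A A | D.IsLocallyNilpotent ∧ D ≠ 0}, {a : A | D a = 0})

namespace Derivation

open TensorProduct

variable {k A B : Type*} [CommRing k] [CommRing A] [Algebra k A] [CommRing B] [Algebra k B]

/-- The derivation `D ⊗ id` of `A ⊗ B` induced by a derivation `D` of `A`. -/
def rTensor (D : Derivation k A A) (B : Type*) [CommRing B] [Algebra k B] :
    Derivation k (A ⊗[k] B) (A ⊗[k] B) :=
  Derivation.mk' ((D : A →ₗ[k] A).rTensor B) fun x y => by
    induction x with
    | zero => simp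
    | add x₁ x₂ h₁ h₂ => simp only [add_mul, map_add, h₁, h₂, add_smul, smul_add]; abel
    | tmul a b =>
      induction y with
      | zero => simp
      | add y₁ y₂ h₁ h₂ => simp only [mul_add, map_add, h₁, h₂, add_smul, smul_add]; abel
      | tmul c d =>
        simp [Algebra.TensorProduct.tmul_mul_tmul, TensorProduct.add_tmul, mul_comm d b]

@[simp]
theorem rTensor_tmul (D : Derivation k A A) (a : A) (b : B) :
    D.rTensor B (a ⊗ₜ b) = D a ⊗ₜ b :=
  rfl

/-- The transport of a derivation along an algebra isomorphism. -/
def conj (D : Derivation k A A) (e : A ≃ₐ[k] B) : Derivation k B B :=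
  Derivation.mk' (e.toLinearMap ∘ₗ (D : A →ₗ[k] A) ∘ₗ e.symm.toLinearMap) fun x y => by
    simp

@[simp]
theorem conj_apply (D : Derivation k A A) (e : A ≃ₐ[k] B) (b : B) :
    D.conj e b = e (D (e.symm b)) :=
  rfl

theorem iterate_eq_zero_of_le (D : Derivation k A A) {a : A} {m n : ℕ} (hmn : m ≤ n)
    (h : (⇑D)^[m] a = 0) : (⇑D)^[n] a = 0 := by
  obtain ⟨l, rfl⟩ := Nat.exists_eq_add_of_le' hmn
  rw [Function.iterate_add_apply, h, iterate_map_zero]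

theorem IsLocallyNilpotent.rTensor {D : Derivation k A A} (hD : D.IsLocallyNilpotent)
    (B : Type*) [CommRing B] [Algebra k B] : (D.rTensor B).IsLocallyNilpotent := by
  intro x
  induction x with
  | zero => exact ⟨1, one_pos, map_zero _⟩
  | tmul a b =>
    obtain ⟨n, hn, h⟩ := hD a
    have key : Function.Semiconj (fun a : A => a ⊗ₜ[k] b) D (D.rTensor B) := fun _ => rfl
    refine ⟨n, hn, ?_⟩
    rw [← (key.iterate_right n).eq, h, TensorProduct.zero_tmul]
  | add x y hx hy =>
    obtain ⟨m, hm, hx⟩ := hx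
    obtain ⟨n, -, hy⟩ := hy
    refine ⟨max m n, hm.trans_le (le_max_left m n), ?_⟩
    rw [iterate_map_add, iterate_eq_zero_of_le _ (le_max_left m n) hx,
      iterate_eq_zero_of_le _ (le_max_right m n) hy, add_zero]

theorem IsLocallyNilpotent.conj {D : Derivation k A A} (hD : D.IsLocallyNilpotent)
    (e : A ≃ₐ[k] B) : (D.conj e).IsLocallyNilpotent := by
  intro b
  obtain ⟨n, hn, h⟩ := hD (e.symm b)
  have key : Function.Semiconj e D (D.conj e) := fun a => by simp
  refine ⟨n, hn, ?_⟩
  rw [← e.apply_symm_apply b, ← (key.iterate_right n).eq, h, map_zero]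

theorem conj_ne_zero {D : Derivation k A A} (hD : D ≠ 0) (e : A ≃ₐ[k] B) : D.conj e ≠ 0 := by
  contrapose! hD
  ext a
  simpa using DFunLike.congr_fun hD (e a)

theorem nontrivial_of_ne_zero {D : Derivation k A A} (hD : D ≠ 0) : Nontrivial A := by
  by_contra h
  rw [not_nontrivial_iff_subsingleton] at h
  exact hD (Derivation.ext fun _ => Subsingleton.elim _ _)

theorem rTensor_ne_zero {k A : Type*} [Field k] [CommRing A] [Algebra k A]
    {D : Derivation k A A} (hD : D ≠ 0) (B : Type*) [CommRing B] [Algebra k B] [Nontrivial B] :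
    D.rTensor B ≠ 0 := by
  contrapose! hD
  ext a
  apply Algebra.TensorProduct.includeLeft_injective (R := k) (S := k) (A := A) (B := B)
    (algebraMap k B).injective
  simpa using DFunLike.congr_fun hD (a ⊗ₜ 1)

end Derivation

theorem mem_derksen {k A : Type*} [CommRing k] [CommRing A] [Algebra k A]
    {D : Derivation k A A} (hD : D.IsLocallyNilpotent) (hD₀ : D ≠ 0) {a : A} (ha : D a = 0) :
    a ∈ Derksen k A :=
  Algebra.subset_adjoin (Set.mem_iUnion₂.mpr ⟨D, ⟨hD, hD₀⟩, ha⟩)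

open TensorProduct in
theorem derksen_tensor_eq_top (k A₁ A₂ : Type*) [Field k] [CharZero k]
    [CommRing A₁] [Algebra k A₁] [CommRing A₂] [Algebra k A₂]
    (h₁ : ∃ D : Derivation k A₁ A₁, D.IsLocallyNilpotent ∧ D ≠ 0)
    (h₂ : ∃ D : Derivation k A₂ A₂, D.IsLocallyNilpotent ∧ D ≠ 0) :
    Derksen k (A₁ ⊗[k] A₂) = ⊤ := by
  obtain ⟨D₁, hD₁, hD₁'⟩ := h₁
  obtain ⟨D₂, hD₂, hD₂'⟩ := h₂
  have := Derivation.nontrivial_of_ne_zero hD₁'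
  have := Derivation.nontrivial_of_ne_zero hD₂'
  rw [eq_top_iff, ← Algebra.TensorProduct.adjoin_tmul_eq_top, Algebra.adjoin_le_iff]
  rintro _ ⟨a, b, rfl⟩
  rw [← mul_one a, ← one_mul b, ← Algebra.TensorProduct.tmul_mul_tmul]
  refine mul_mem ?_ ?_
  · exact mem_derksen ((hD₂.rTensor A₁).conj (Algebra.TensorProduct.comm k A₂ A₁))
      (Derivation.conj_ne_zero (Derivation.rTensor_ne_zero hD₂' A₁) _) (by simp)
  · exact mem_derksen (hD₁.rTensor A₂) (Derivation.rTensor_ne_zero hD₁' A₂) (by simp)
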